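/- Let f be a measurable classifier on ℝ^d outputting exactly one label from {1,…,c} (the case k' = 1). Fix x ∈ ℝ^d, σ > 0, R > 0, and a label a ∈ {1,…,c}. For δ ∈ ℝ^d, let p*(δ)_i = Pr(f(x + δ + ε) = i) where ε ∼ N(0, σ²I); write p_i = p*(0)_i. Suppose p̲ ∈ (0,1) and p̄ ∈ (0,1) satisfy p_a ≥ p̲ and p_j ≤ p̄ for every j ≠ a, and suppose Φ(Φ⁻¹(p̲) − R/σ) > Φ(Φ⁻¹(p̄) + R/σ). Then for every δ ∈ ℝ^d with ‖δ‖₂ ≤ R and every j ≠ a, p*(δ)_a > p*(δ)_j; in particular the smoothed classifier, which predicts a label with the largest probability p*(δ)_i, predicts label a for x + δ. -/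

import Mathlib

open MeasureTheory ProbabilityTheory

/-- Isotropic Gaussian measure `N(m, σ²I)` on `ℝ^d`, as a product of 1-D Gaussians. -/
noncomputable def gaussPi (d : ℕ) (m : Fin d → ℝ) (σ : ℝ) : Measure (Fin d → ℝ) :=
  Measure.pi fun i => gaussianReal (m i) ⟨σ ^ 2, sq_nonneg σ⟩

/-- Standard Gaussian CDF `Φ`. -/
noncomputable def Phi (x : ℝ) : ℝ := (gaussianReal 0 1 (Set.Iic x)).toReal

/-- Inverse of the standard Gaussian CDF, `Φ⁻¹` (genuine inverse on `(0,1)` since `Φ` is a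
strictly increasing continuous bijection from `ℝ` onto `(0,1)`). -/
noncomputable def PhiInv : ℝ → ℝ := Function.invFun Phi

/-- Euclidean norm `‖a‖₂` on `ℝ^d`. -/
noncomputable def enorm2 (d : ℕ) (a : Fin d → ℝ) : ℝ := Real.sqrt (∑ i, a i ^ 2)

open scoped NNReal ENNReal Topology
open Filter

/-! ### The standard Gaussian CDF -/

lemma Phi_eq_cdf : Phi = cdf (gaussianReal 0 1) := by
  ext x
  rw [cdf_eq_real]
  rfl

lemma monotone_Phi : Monotone Phi := by
  rw [Phi_eq_cdf]
  exact monotone_cdf _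

lemma continuous_Phi : Continuous Phi := by
  have := nullSingletonClass_gaussianReal (μ := 0) (v := 1) one_ne_zero
  rw [Phi_eq_cdf, continuous_iff_continuousAt]
  intro x
  rw [(monotone_cdf _).continuousAt_iff_leftLim_eq_rightLim, StieltjesFunction.rightLim_eq]
  have h : (cdf (gaussianReal 0 1)).measure {x} = 0 := by rw [measure_cdf, measure_singleton]
  rw [StieltjesFunction.measure_singleton, ENNReal.ofReal_eq_zero, sub_nonpos] at h
  exact le_antisymm ((monotone_cdf _).leftLim_le le_rfl) h

lemma Phi_PhiInv {p : ℝ} (hp : p ∈ Set.Ioo (0 : ℝ) 1) : Phi (PhiInv p) = p := by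
  refine Function.invFun_eq ?_
  have hbot : Tendsto Phi atBot (𝓝 0) := Phi_eq_cdf ▸ tendsto_cdf_atBot _
  have htop : Tendsto Phi atTop (𝓝 1) := Phi_eq_cdf ▸ tendsto_cdf_atTop _
  exact mem_range_of_exists_le_of_exists_ge continuous_Phi
    ((hbot.eventually_le_const hp.1).exists) ((htop.eventually_const_le hp.2).exists)

lemma gaussianReal_one_Iic (m y : ℝ) :
    (gaussianReal m 1).real (Set.Iic y) = Phi (y - m) := by
  rw [Phi, ← measureReal_def, ← sub_self m, ← gaussianReal_map_sub_const m,
    map_measureReal_apply (by fun_prop) measurableSet_Iic]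
  congr 1
  ext z
  simp

lemma Phi_neg (y : ℝ) : Phi (-y) = 1 - Phi y := by
  have := nullSingletonClass_gaussianReal (μ := 0) (v := 1) one_ne_zero
  have h := gaussianReal_map_neg (μ := 0) (v := 1)
  rw [neg_zero] at h
  rw [Phi, Phi, ← measureReal_def, ← measureReal_def, ← probReal_compl_eq_one_sub measurableSet_Iic,
    Set.compl_Iic, ← measureReal_congr (Ioi_ae_eq_Ici (a := y)).symm]
  conv_lhs => rw [← h, map_measureReal_apply (by fun_prop) measurableSet_Iic]
  congr 1
  ext z
  simp

/-! ### Products of measures with densities, and shifted Gaussians -/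

lemma pi_withDensity {ι : Type*} [Fintype ι] {X : ι → Type*} [∀ i, MeasurableSpace (X i)]
    (μ : ∀ i, Measure (X i)) [∀ i, IsProbabilityMeasure (μ i)] (g : ∀ i, X i → ℝ≥0∞)
    [∀ i, SigmaFinite ((μ i).withDensity (g i))] (hg : ∀ i, Measurable (g i)) :
    Measure.pi (fun i ↦ (μ i).withDensity (g i)) =
      (Measure.pi μ).withDensity (fun w ↦ ∏ i, g i (w i)) := by
  refine Measure.pi_eq fun s hs ↦ ?_
  have hmeas i : Measurable ((s i).indicator (g i)) := (hg i).indicator (hs i)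
  have hind : (Set.univ.pi s).indicator (fun w : ∀ i, X i ↦ ∏ i, g i (w i)) =
      fun w ↦ ∏ i, (s i).indicator (g i) (w i) := by
    classical
    ext w
    by_cases hw : w ∈ Set.univ.pi s
    · rw [Set.indicator_of_mem hw]
      exact Finset.prod_congr rfl fun i _ ↦ (Set.indicator_of_mem (hw i (Set.mem_univ i)) _).symm
    · rw [Set.indicator_of_notMem hw]
      simp only [Set.mem_univ_pi, not_forall] at hw
      obtain ⟨i, hi⟩ := hw
      exact (Finset.prod_eq_zero (Finset.mem_univ i) (Set.indicator_of_notMem hi _)).symm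
  rw [withDensity_apply _ (.univ_pi hs), ← lintegral_indicator (.univ_pi hs), hind]
  rw [lintegral_prod_eq_prod_lintegral_of_indepFun Finset.univ
      (fun i (w : ∀ i, X i) ↦ (s i).indicator (g i) (w i))
      (iIndepFun_pi fun i ↦ (hmeas i).aemeasurable)
      fun i ↦ (hmeas i).comp (measurable_pi_apply i)]
  refine Finset.prod_congr rfl fun i _ ↦ ?_
  rw [withDensity_apply _ (hs i), ← lintegral_indicator (hs i)]
  exact (measurePreserving_eval μ i).lintegral_comp (hmeas i)

lemma gaussianReal_add_eq_withDensity (m d : ℝ) {v : ℝ≥0} (hv : v ≠ 0) :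
    gaussianReal (m + d) v = (gaussianReal m v).withDensity
      (fun y ↦ ENNReal.ofReal (Real.exp ((d * (y - m) - d ^ 2 / 2) / v))) := by
  rw [gaussianReal_of_var_ne_zero _ hv, gaussianReal_of_var_ne_zero _ hv,
    ← withDensity_mul _ (measurable_gaussianPDF _ _) (by fun_prop)]
  congr 1
  ext y
  have hv' : (v : ℝ) ≠ 0 := by exact_mod_cast hv
  rw [Pi.mul_apply, gaussianPDF, gaussianPDF, ← ENNReal.ofReal_mul (gaussianPDFReal_nonneg _ _ _),
    gaussianPDFReal, gaussianPDFReal, mul_assoc (_)⁻¹, ← Real.exp_add]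
  congr 3
  field_simp
  ring

lemma gaussPi_eq_pi (d : ℕ) (m : Fin d → ℝ) (σ : ℝ) :
    gaussPi d m σ = Measure.pi fun i ↦ gaussianReal (m i) (.mk (σ ^ 2) (sq_nonneg σ)) := rfl

lemma gaussPi_add_eq_withDensity (d : ℕ) (x δ : Fin d → ℝ) {σ : ℝ} (hσ : 0 < σ) :
    gaussPi d (x + δ) σ = (gaussPi d x σ).withDensity
      (fun w ↦ ENNReal.ofReal
        (Real.exp ((∑ i, δ i * w i - ∑ i, (δ i * x i + δ i ^ 2 / 2)) / σ ^ 2))) := by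
  have hv : NNReal.mk (σ ^ 2) (sq_nonneg σ) ≠ 0 := by
    rw [← NNReal.coe_ne_zero]
    exact (pow_pos hσ 2).ne'
  have hd i := gaussianReal_add_eq_withDensity (x i) (δ i) hv
  have (i : Fin d) := hd i ▸ (inferInstance : SigmaFinite (gaussianReal (x i + δ i) _))
  simp only [gaussPi_eq_pi, Pi.add_apply, hd]
  rw [pi_withDensity _ _ (by fun_prop)]
  congr 1
  ext w
  rw [← ENNReal.ofReal_prod_of_nonneg fun i _ ↦ (Real.exp_pos _).le, ← Real.exp_sum,
    ← Finset.sum_sub_distrib, Finset.sum_div]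
  congr 2
  refine Finset.sum_congr rfl fun i _ ↦ ?_
  rw [NNReal.coe_mk]
  ring

instance isProbabilityMeasure_gaussPi (d : ℕ) (m : Fin d → ℝ) (σ : ℝ) :
    IsProbabilityMeasure (gaussPi d m σ) := by
  rw [gaussPi_eq_pi]
  infer_instance

lemma gaussPi_map_sum_mul (d : ℕ) (m b : Fin d → ℝ) (σ : ℝ) (hb : σ ^ 2 * ∑ i, b i ^ 2 = 1) :
    (gaussPi d m σ).map (fun w ↦ ∑ i, b i * w i) = gaussianReal (∑ i, b i * m i) 1 := by
  have hcomp : (fun w : Fin d → ℝ ↦ ∑ i, b i * w i) =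
      (fun p : Fin d → ℝ ↦ ∑ i, p i) ∘ (fun w i ↦ b i * w i) := rfl
  have (i : Fin d) : IsProbabilityMeasure
      ((gaussianReal (m i) (.mk (σ ^ 2) (sq_nonneg σ))).map (b i * ·)) :=
    Measure.isProbabilityMeasure_map (by fun_prop)
  rw [gaussPi_eq_pi, hcomp, ← Measure.map_map (by fun_prop) (by fun_prop),
    Measure.pi_map_pi (f := fun i y ↦ b i * y) (by fun_prop)]
  refine Measure.ext_of_charFun ?_
  rw [charFun_map_sum_pi_eq_prod]
  ext t
  simp only [gaussianReal_map_const_mul, Finset.prod_apply, charFun_gaussianReal]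
  rw [← Complex.exp_sum]
  congr 1
  have hb' : (σ : ℂ) ^ 2 * ∑ i, (b i : ℂ) ^ 2 = 1 := by exact_mod_cast hb
  rw [Finset.sum_sub_distrib, NNReal.coe_one, Complex.ofReal_one, ← hb']
  simp only [NNReal.coe_mul, NNReal.coe_mk, Complex.ofReal_mul, Complex.ofReal_pow,
    Complex.ofReal_sum, Finset.mul_sum, Finset.sum_mul, Finset.sum_div]
  congr 1
  exact Finset.sum_congr rfl fun i _ ↦ by ring

lemma gaussPi_real_halfspace (d : ℕ) (m b : Fin d → ℝ) (σ y : ℝ)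
    (hb : σ ^ 2 * ∑ i, b i ^ 2 = 1) :
    (gaussPi d m σ).real {w | ∑ i, b i * w i ≤ y} = Phi (y - ∑ i, b i * m i) := by
  rw [← gaussianReal_one_Iic, ← gaussPi_map_sum_mul d m b σ hb,
    map_measureReal_apply (by fun_prop) measurableSet_Iic]
  rfl

/-! ### The Neyman–Pearson comparison -/

/-- **Neyman–Pearson lemma**: among the sets of `μ`-mass at least `μ H`, a sublevel set `H` of the
likelihood ratio minimises the mass under the alternative. -/
lemma withDensity_apply_le_of_sublevel {α : Type*} [MeasurableSpace α] {μ : Measure α}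
    [IsFiniteMeasure μ] {g : α → ℝ≥0∞} {H A : Set α} (hH : MeasurableSet H)
    (hA : MeasurableSet A) (k : ℝ≥0∞) (hgH : ∀ w ∈ H, g w ≤ k) (hgHc : ∀ w ∉ H, k ≤ g w)
    (h : μ H ≤ μ A) : μ.withDensity g H ≤ μ.withDensity g A := by
  have hdiff : μ (H \ A) ≤ μ (A \ H) := by
    rw [← measure_inter_add_sdiff H hA, ← measure_inter_add_sdiff A hH, Set.inter_comm] at h
    exact (ENNReal.add_le_add_iff_left (measure_ne_top _ _)).1 h
  rw [← measure_inter_add_sdiff H hA, ← measure_inter_add_sdiff A hH, Set.inter_comm]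
  gcongr _ + ?_
  rw [withDensity_apply _ (hH.diff hA), withDensity_apply _ (hA.diff hH)]
  calc ∫⁻ w in H \ A, g w ∂μ
      ≤ ∫⁻ _ in H \ A, k ∂μ := setLIntegral_mono measurable_const fun w hw ↦ hgH w hw.1
    _ = k * μ (H \ A) := setLIntegral_const _ _
    _ ≤ k * μ (A \ H) := by gcongr
    _ = ∫⁻ _ in A \ H, k ∂μ := (setLIntegral_const _ _).symm
    _ ≤ ∫⁻ w in A \ H, g w ∂μ := setLIntegral_mono' (hA.diff hH) fun w hw ↦ hgHc w hw.2

lemma Phi_sub_le_gaussPi_add (d : ℕ) (x δ : Fin d → ℝ) {σ : ℝ} (hσ : 0 < σ)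
    {A : Set (Fin d → ℝ)} (hA : MeasurableSet A) {s : ℝ} (h : Phi s ≤ (gaussPi d x σ).real A) :
    Phi (s - enorm2 d δ / σ) ≤ (gaussPi d (x + δ) σ).real A := by
  have hn : enorm2 d δ ^ 2 = ∑ i, δ i ^ 2 := Real.sq_sqrt (by positivity)
  obtain h0 | hpos := (show 0 ≤ enorm2 d δ from Real.sqrt_nonneg _).eq_or_lt
  · have hδ : δ = 0 := by
      rw [← h0, zero_pow two_ne_zero, eq_comm,
        Finset.sum_eq_zero_iff_of_nonneg fun i _ ↦ sq_nonneg _] at hn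
      ext i
      exact pow_eq_zero_iff two_ne_zero |>.1 (hn i (Finset.mem_univ i))
    rw [← h0, hδ, zero_div, sub_zero, add_zero]
    exact h
  set n := enorm2 d δ
  set b : Fin d → ℝ := fun i ↦ δ i / (σ * n)
  have hσn : 0 < σ * n := mul_pos hσ hpos
  have hb : σ ^ 2 * ∑ i, b i ^ 2 = 1 := by
    simp only [b, div_pow]
    rw [← Finset.sum_div, ← hn]
    field_simp
  have hbδ : ∑ i, b i * δ i = n / σ := by
    have : ∀ i, b i * δ i = δ i ^ 2 / (σ * n) := fun i ↦ by simp only [b]; ring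
    simp only [this]
    rw [← Finset.sum_div, ← hn]
    field_simp
  have hbw (w : Fin d → ℝ) : ∑ i, δ i * w i = σ * n * ∑ i, b i * w i := by
    rw [Finset.mul_sum]
    refine Finset.sum_congr rfl fun i _ ↦ ?_
    simp only [b]
    field_simp
  set y := s + ∑ i, b i * x i with hy
  have hH : MeasurableSet {w : Fin d → ℝ | ∑ i, b i * w i ≤ y} :=
    measurableSet_le (by fun_prop) measurable_const
  have h₀ : (gaussPi d x σ).real {w | ∑ i, b i * w i ≤ y} = Phi s := by
    rw [gaussPi_real_halfspace d x b σ y hb, hy, add_sub_cancel_right]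
  have h₁ : (gaussPi d (x + δ) σ).real {w | ∑ i, b i * w i ≤ y} = Phi (s - n / σ) := by
    rw [gaussPi_real_halfspace d (x + δ) b σ y hb]
    simp only [Pi.add_apply, mul_add, Finset.sum_add_distrib, hbδ]
    congr 1
    rw [hy]
    ring
  rw [← h₀] at h
  rw [← h₁]
  refine ENNReal.toReal_mono (measure_ne_top _ _) ?_
  rw [gaussPi_add_eq_withDensity d x δ hσ]
  refine withDensity_apply_le_of_sublevel hH hA (ENNReal.ofReal
    (Real.exp ((σ * n * y - ∑ i, (δ i * x i + δ i ^ 2 / 2)) / σ ^ 2))) ?_ ?_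
    ((ENNReal.toReal_le_toReal (measure_ne_top _ _) (measure_ne_top _ _)).1 h)
  · intro w hw
    rw [hbw]
    have hw' : ∑ i, b i * w i ≤ y := hw
    gcongr
  · intro w hw
    rw [hbw]
    have hw' : y ≤ ∑ i, b i * w i := (not_le.1 hw).le
    gcongr

lemma gaussPi_add_le_Phi_add (d : ℕ) (x δ : Fin d → ℝ) {σ : ℝ} (hσ : 0 < σ)
    {A : Set (Fin d → ℝ)} (hA : MeasurableSet A) {s : ℝ} (h : (gaussPi d x σ).real A ≤ Phi s) :
    (gaussPi d (x + δ) σ).real A ≤ Phi (s + enorm2 d δ / σ) := by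
  have hc : Phi (-s) ≤ (gaussPi d x σ).real Aᶜ := by
    rw [probReal_compl_eq_one_sub hA, Phi_neg]
    linarith
  have := Phi_sub_le_gaussPi_add d x δ hσ hA.compl hc
  rw [probReal_compl_eq_one_sub hA, ← neg_add', Phi_neg] at this
  linarith

/-- The `k' = 1` special case (Cohen et al.): `f` is a measurable classifier on `ℝ^dd`
outputting one label from `{1,…,c}`, and `pstar δ i = Pr(f(x+δ+ε) = i)` with
`ε ~ N(0,σ²I)` (so `x+δ+ε ~ N(x+δ, σ²I)`). If `p̲, p̄ ∈ (0,1)` satisfy `p_a ≥ p̲`,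
`p_j ≤ p̄` for every `j ≠ a`, and `Φ(Φ⁻¹(p̲) − R/σ) > Φ(Φ⁻¹(p̄) + R/σ)`, then for every
`δ` with `‖δ‖₂ ≤ R` and every `j ≠ a`, `pstar δ a > pstar δ j`; i.e. the smoothed
classifier predicts label `a` for `x + δ`. -/
theorem stmt17 (dd c : ℕ)
    (f : (Fin dd → ℝ) → Fin c)
    (hfm : ∀ i : Fin c, MeasurableSet {w : Fin dd → ℝ | f w = i})
    (x : Fin dd → ℝ) (σ R : ℝ) (hσ : 0 < σ) (hR : 0 < R)
    (a : Fin c)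
    (pstar : (Fin dd → ℝ) → Fin c → ℝ)
    (hpstar : ∀ δ i, pstar δ i = ((gaussPi dd (x + δ) σ) {w | f w = i}).toReal)
    (plow pupp : ℝ) (hlow : plow ∈ Set.Ioo (0 : ℝ) 1) (hupp : pupp ∈ Set.Ioo (0 : ℝ) 1)
    (hpa : plow ≤ pstar 0 a)
    (hpj : ∀ j, j ≠ a → pstar 0 j ≤ pupp)
    (hcond : Phi (PhiInv pupp + R / σ) < Phi (PhiInv plow - R / σ)) :
    ∀ δ : Fin dd → ℝ, enorm2 dd δ ≤ R →
      ∀ j : Fin c, j ≠ a → pstar δ j < pstar δ a := by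
  intro δ hδ j hj
  have hr : enorm2 dd δ / σ ≤ R / σ := by gcongr
  simp only [hpstar, add_zero] at hpa hpj ⊢
  have hlo := Phi_sub_le_gaussPi_add dd x δ hσ (hfm a) ((Phi_PhiInv hlow).trans_le hpa)
  have hup := gaussPi_add_le_Phi_add dd x δ hσ (hfm j) ((hpj j hj).trans_eq (Phi_PhiInv hupp).symm)
  calc _ ≤ Phi (PhiInv pupp + enorm2 dd δ / σ) := hup
    _ ≤ Phi (PhiInv pupp + R / σ) := monotone_Phi (by gcongr)
    _ < Phi (PhiInv plow - R / σ) := hcond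
    _ ≤ Phi (PhiInv plow - enorm2 dd δ / σ) := monotone_Phi (by gcongr)
    _ ≤ _ := hlo
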